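/- arXiv:2111.04622 — 2 statements merged into one kernel-verified Lean document; each statement's English description precedes it below -/
import Mathlib

section
/- Let k be a field of characteristic zero and let (V, L, N, Y, Y') and (V̂, L̂, N̂, Ŷ, Ŷ') be Deligne systems on finite-dimensional k-vector spaces V, V̂. Let T : V → V̂ be a k-linear map such that Ŷ∘T = T∘Y, N̂∘T = T∘N, and T(L_i) ⊆ L̂_i for all i ∈ ℤ. Then Ŷ'∘T = T∘Y'. -/
noncomputable section

variable {k : Type*} [Field k] {V : Type*} [AddCommGroup V] [Module k V]

/-- `Y₀` is a *splitting operator* for the finite increasing filtration `L`: a semisimple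
endomorphism, all of whose eigenvalues are integers (encoded as: the integer eigenspaces
span), with `L i = ⊕_{j ≤ i} ker (Y₀ - j·id)` for every `i`. -/
def IsSplittingOp (Y₀ : Module.End k V) (L : ℤ → Submodule k V) : Prop :=
  (⨆ j : ℤ, LinearMap.ker (Y₀ - (j : k) • 1)) = ⊤ ∧
  ∀ i : ℤ, L i = ⨆ j : ℤ, ⨆ _ : j ≤ i, LinearMap.ker (Y₀ - (j : k) • 1)

/-- The compatibility condition making `(V, L, N, Y, Y')` a Deligne system: writing
`N = Σ_{j ≤ 0} N_j` for the `ad Y'`-homogeneous components of `N`, there exists `e⁺` with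
`[e⁺, N_0] = Y - Y'`, `[Y - Y', e⁺] = 2e⁺` and `[e⁺, N_j] = 0` for all `j ≠ 0`. -/
def DeligneCompat (Y Y' N : Module.End k V) : Prop :=
  ∃ Nc : ℤ → Module.End k V,
    (Function.support Nc).Finite ∧
    (∀ j : ℤ, 0 < j → Nc j = 0) ∧
    (∑ᶠ j : ℤ, Nc j) = N ∧
    (∀ j : ℤ, Y' * Nc j - Nc j * Y' = (j : k) • Nc j) ∧
    ∃ e : Module.End k V,
      e * Nc 0 - Nc 0 * e = Y - Y' ∧
      (Y - Y') * e - e * (Y - Y') = (2 : k) • e ∧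
      ∀ j : ℤ, j ≠ 0 → e * Nc j = Nc j * e

/-- A *Deligne system* `(V, L, N, Y, Y')`: a finite increasing filtration `L` of `V`; a
nilpotent `N` preserving `L`; a semisimple `Y` with integer eigenvalues satisfying
`[Y, N] = -2N` and `Y(L_i) ⊆ L_i`; and a splitting operator `Y'` for `L` commuting with
`Y` satisfying the Deligne compatibility condition. -/
def IsDeligneSystem (L : ℤ → Submodule k V) (N Y Y' : Module.End k V) : Prop :=
  Monotone L ∧ (∃ a : ℤ, L a = ⊥) ∧ (∃ b : ℤ, L b = ⊤) ∧
  IsNilpotent N ∧ (∀ i : ℤ, ∀ x ∈ L i, N x ∈ L i) ∧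
  (⨆ a : ℤ, LinearMap.ker (Y - (a : k) • 1)) = ⊤ ∧
  Y * N - N * Y = (-2 : k) • N ∧ (∀ i : ℤ, ∀ x ∈ L i, Y x ∈ L i) ∧
  IsSplittingOp Y' L ∧ Commute Y Y' ∧ DeligneCompat Y Y' N

/-- Eigenvectors for distinct integer eigenvalues that sum to zero all vanish. -/
theorem eq_zero_of_sum_intEigen_eq_zero [CharZero k] (D : Module.End k V) (s : Finset ℤ)
    (g : ℤ → V) (hg : ∀ i ∈ s, D (g i) = (i : k) • g i) (h : ∑ i ∈ s, g i = 0) :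
    ∀ i ∈ s, g i = 0 := by
  have hind : iSupIndep fun i : ℤ ↦ D.eigenspace (i : k) :=
    D.eigenspaces_iSupIndep.comp Int.cast_injective
  rw [iSupIndep_iff_finsetSum_eq_zero_imp_eq_zero] at hind
  exact hind s g (fun i hi ↦ Module.End.mem_eigenspace_iff.2 (hg i hi)) h

/-- If `[H, e] = 2e` and `[e, f] = H` on a finite-dimensional space, then `e ∘ f` is injective on
the eigenspaces of `H` for positive weights. -/
theorem eq_zero_of_raise_lower_eq_zero [CharZero k] [FiniteDimensional k V]
    (H e f : Module.End k V) (hHe : H * e - e * H = (2 : k) • e) (hef : e * f - f * e = H)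
    (w : ℕ) (hw : 0 < w) (x : V) (hx : H x = (w : k) • x) (h : e (f x) = 0) : x = 0 := by
  by_contra hx0
  have hHe' (y : V) : H (e y) = e (H y) + (2 : k) • e y := by
    have := LinearMap.congr_fun hHe y
    simp only [LinearMap.sub_apply, Module.End.mul_apply, LinearMap.smul_apply] at this
    rw [← this]; abel
  have hfe (y : V) : f (e y) = e (f y) - H y := by
    rw [← hef]; simp
  have hH (n : ℕ) : H ((e ^ n) x) = ((w + 2 * n : ℕ) : k) • (e ^ n) x := by
    induction n with
    | zero => simpa using hx
    | succ n ih =>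
      rw [pow_succ', Module.End.mul_apply, hHe', ih, map_smul, ← add_smul]
      congr 1; push_cast; ring
  have hf (n : ℕ) : f ((e ^ (n + 1)) x) = -(((n + 1) * (w + n) : ℕ) : k) • (e ^ n) x := by
    induction n with
    | zero => simp [hfe, h, hx]
    | succ n ih =>
      rw [pow_succ' e (n + 1), Module.End.mul_apply, hfe, ih, hH, map_smul, ← Module.End.mul_apply,
        ← pow_succ', ← sub_smul]
      congr 1; push_cast; ring
  have hne (n : ℕ) : (e ^ n) x ≠ 0 := by
    induction n with
    | zero => simpa using hx0
    | succ n ih =>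
      intro h0
      have := hf n
      rw [h0, map_zero, eq_comm, smul_eq_zero, neg_eq_zero, Nat.cast_eq_zero] at this
      rcases this with h1 | h1
      · have : 0 < (n + 1) * (w + n) := by positivity
        omega
      · exact ih h1
  have hinj : Function.Injective fun n : ℕ ↦ ((w + 2 * n : ℕ) : k) := fun a b hab ↦ by
    have : w + 2 * a = w + 2 * b := Nat.cast_injective hab
    omega
  exact Set.infinite_range_of_injective hinj <| H.finite_hasEigenvalue.subset <| by
    rintro _ ⟨n, rfl⟩
    exact Module.End.hasEigenvalue_of_hasEigenvector
      ⟨Module.End.mem_eigenspace_iff.2 (hH n), hne n⟩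

/-- Let `D`, `Y` commute and let `n i` be `ad D`-homogeneous of degree `i ≤ 0`, with `n 0` part of an
`𝔰𝔩₂`-triple `(e, Y - D, n 0)` such that `e` commutes with the other `n i`. A sum of
`D`-eigenvectors of nonpositive weights that is killed by `Y` and by `∑ i, n i` is killed by
`D`. -/
theorem apply_eq_zero_of_deligne_triple [CharZero k] [FiniteDimensional k V]
    (D Y e : Module.End k V) (n : ℤ → Module.End k V) (I J : Finset ℤ)
    (hnI : ∀ i ∉ I, n i = 0) (hn0 : ∀ i, 0 < i → n i = 0)
    (hn : ∀ i, D * n i - n i * D = (i : k) • n i)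
    (he0 : e * n 0 - n 0 * e = Y - D)
    (heH : (Y - D) * e - e * (Y - D) = (2 : k) • e)
    (hen : ∀ i, i ≠ 0 → e * n i = n i * e)
    (hYD : Commute Y D) (t : ℤ → V)
    (htJ : ∀ j ∉ J, t j = 0) (ht0 : ∀ j, 0 < j → t j = 0)
    (ht : ∀ j, D (t j) = (j : k) • t j)
    (hY : Y (∑ j ∈ J, t j) = 0) (hN : (∑ i ∈ I, n i) (∑ j ∈ J, t j) = 0) :
    D (∑ j ∈ J, t j) = 0 := by
  have hYt (j : ℤ) : Y (t j) = 0 := by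
    by_cases hj : j ∈ J
    · rw [map_sum] at hY
      refine eq_zero_of_sum_intEigen_eq_zero D J (fun j ↦ Y (t j)) (fun i _ ↦ ?_) hY j hj
      rw [← Module.End.mul_apply, ← hYD.eq, Module.End.mul_apply, ht, map_smul]
    · rw [htJ j hj, map_zero]
  have hnt (i j : ℤ) : D (n i (t j)) = ((i + j : ℤ) : k) • n i (t j) := by
    have := LinearMap.congr_fun (hn i) (t j)
    simp only [LinearMap.sub_apply, Module.End.mul_apply, LinearMap.smul_apply, ht, map_smul]
      at this
    rw [Int.cast_add, add_smul, ← this]; abel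
  have hcomp (m : ℤ) : ∑ p ∈ I ×ˢ J with p.1 + p.2 = m, n p.1 (t p.2) = 0 := by
    classical
    by_cases hm : m ∈ (I ×ˢ J).image fun p ↦ p.1 + p.2
    · refine eq_zero_of_sum_intEigen_eq_zero D ((I ×ˢ J).image fun p ↦ p.1 + p.2)
        (fun m ↦ ∑ p ∈ I ×ˢ J with p.1 + p.2 = m, n p.1 (t p.2)) (fun m _ ↦ ?_) ?_ m hm
      · rw [map_sum, Finset.smul_sum]
        refine Finset.sum_congr rfl fun p hp ↦ ?_
        rw [hnt, (Finset.mem_filter.1 hp).2]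
      · rw [Finset.sum_fiberwise_of_maps_to fun p hp ↦ Finset.mem_image_of_mem _ hp,
          Finset.sum_product, ← hN, LinearMap.sum_apply]
        exact Finset.sum_congr rfl fun i _ ↦ (map_sum (n i) _ _).symm
    · refine Finset.sum_eq_zero fun p hp ↦ (hm ?_).elim
      rw [Finset.mem_filter] at hp
      exact Finset.mem_image.2 ⟨p, hp⟩
  have hlead (φ : Module.End k V) (m : ℤ)
      (h : ∀ i j, i + j = m → i < 0 → φ (n i (t j)) = 0) : φ (n 0 (t m)) = 0 := by
    have := congr_arg φ (hcomp m)
    rw [map_sum, map_zero, Finset.sum_eq_single (0, m)] at this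
    · exact this
    · rintro ⟨i, j⟩ hp hne
      have hij : i + j = m := (Finset.mem_filter.1 hp).2
      rcases lt_trichotomy i 0 with hi | hi | hi
      · exact h i j hij hi
      · subst hi
        exact (hne (by simp [← hij])).elim
      · simp [hn0 i hi]
    · intro hp
      by_cases h0 : (0 : ℤ) ∈ I
      · have : m ∉ J := fun hm ↦ hp (by simp [h0, hm])
        simp [htJ m this]
      · simp [hnI 0 h0]
  have hHt (j : ℤ) : (Y - D) (t j) = -(j : k) • t j := by
    rw [LinearMap.sub_apply, hYt, ht, zero_sub, neg_smul]
  have hft : n 0 (t 0) = 0 := hlead 1 0 fun i j hij hi ↦ by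
    rw [ht0 j (by omega), map_zero, map_zero]
  have het : e (t 0) = 0 := by
    refine eq_zero_of_raise_lower_eq_zero (Y - D) e (n 0) heH he0 2 two_pos _ ?_ ?_
    · have := LinearMap.congr_fun heH (t 0)
      simpa [hYt, ht] using this
    · have : n 0 (e (t 0)) = 0 := by
        have := LinearMap.congr_fun he0 (t 0)
        simpa [hYt, ht, hft] using this
      rw [this, map_zero]
  have hneg (m : ℕ) : t (-(m + 1 : ℕ)) = 0 := by
    induction m using Nat.strong_induction_on with
    | _ m ih =>
      refine eq_zero_of_raise_lower_eq_zero (Y - D) e (n 0) heH he0 (m + 1) m.succ_pos _ ?_ ?_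
      · rw [hHt]; congr 1; push_cast; ring
      · refine hlead e _ fun i j hij hi ↦ ?_
        rcases lt_trichotomy j 0 with hj | rfl | hj
        · obtain ⟨l, rfl⟩ : ∃ l : ℕ, j = -(l + 1 : ℕ) := ⟨(-j - 1).toNat, by omega⟩
          rw [ih l (by omega), map_zero, map_zero]
        · rw [← Module.End.mul_apply, hen i hi.ne, Module.End.mul_apply, het, map_zero]
        · rw [ht0 j hj, map_zero, map_zero]
  rw [map_sum]
  refine Finset.sum_eq_zero fun j _ ↦ ?_
  rcases lt_trichotomy j 0 with hj | rfl | hj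
  · obtain ⟨l, rfl⟩ : ∃ l : ℕ, j = -(l + 1 : ℕ) := ⟨(-j - 1).toNat, by omega⟩
    rw [hneg, map_zero]
  · simp [ht]
  · rw [ht0 j hj, map_zero]

/-- The action `T ↦ A ∘ T - T ∘ B` of a pair of endomorphisms on linear maps. -/
def homAction {W : Type*} [AddCommGroup W] [Module k W] (A : Module.End k W)
    (B : Module.End k V) : Module.End k (V →ₗ[k] W) where
  toFun T := A ∘ₗ T - T ∘ₗ B
  map_add' S T := by ext; simp; abel
  map_smul' c T := by ext; simp [smul_sub]

section homAction

variable {W : Type*} [AddCommGroup W] [Module k W]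

theorem homAction_apply (A : Module.End k W) (B : Module.End k V) (T : V →ₗ[k] W) :
    homAction A B T = A ∘ₗ T - T ∘ₗ B := rfl

theorem homAction_sub (A A' : Module.End k W) (B B' : Module.End k V) :
    homAction (A - A') (B - B') = homAction A B - homAction A' B' := by
  ext; simp [homAction_apply]; abel

theorem homAction_smul (c : k) (A : Module.End k W) (B : Module.End k V) :
    homAction (c • A) (c • B) = c • homAction A B := by
  ext; simp [homAction_apply, smul_sub]

theorem homAction_commutator (A A' : Module.End k W) (B B' : Module.End k V) :
    homAction A B * homAction A' B' - homAction A' B' * homAction A B =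
      homAction (A * A' - A' * A) (B * B' - B' * B) := by
  ext; simp [homAction_apply]; abel

theorem sum_homAction (s : Finset ℤ) (A : ℤ → Module.End k W) (B : ℤ → Module.End k V) :
    ∑ i ∈ s, homAction (A i) (B i) = homAction (∑ i ∈ s, A i) (∑ i ∈ s, B i) := by
  ext; simp [homAction_apply, LinearMap.sum_apply]

end homAction

/-- An endomorphism whose integer eigenspaces span has an eigenbasis. -/
theorem exists_basis_intEigen [CharZero k] [FiniteDimensional k V] (A : Module.End k V)
    (hA : ⨆ j : ℤ, LinearMap.ker (A - (j : k) • 1) = ⊤) :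
    ∃ (ι : Type) (_ : Fintype ι) (b : Module.Basis ι k V) (μ : ι → ℤ),
      ∀ i, A (b i) = (μ i : k) • b i := by
  have hind : iSupIndep fun i : ℤ ↦ A.eigenspace (i : k) :=
    A.eigenspaces_iSupIndep.comp Int.cast_injective
  have hspan : ⨆ i : ℤ, A.eigenspace (i : k) = ⊤ := by
    rw [← hA]
    refine iSup_congr fun j ↦ ?_
    ext x
    simp [sub_eq_zero]
  have hint := DirectSum.isInternal_submodule_of_iSupIndep_of_iSup_eq_top hind hspan
  let b := hint.collectedBasis fun i ↦
    Module.finBasis k (A.eigenspace (i : k))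
  exact ⟨_, FiniteDimensional.fintypeBasisIndex b, b, Sigma.fst, fun i ↦
    Module.End.mem_eigenspace_iff.1 (hint.collectedBasis_mem _ i)⟩

/-- A filtered map is a sum of homogeneous maps of nonpositive degrees for the grading
induced by splitting operators. -/
theorem exists_homogeneous_decomposition [CharZero k] [FiniteDimensional k V]
    {W : Type*} [AddCommGroup W] [Module k W]
    {L : ℤ → Submodule k V} {M : ℤ → Submodule k W} {A : Module.End k V} {B : Module.End k W}
    (hA : IsSplittingOp A L) (hB : IsSplittingOp B M) (T : V →ₗ[k] W)
    (hT : ∀ i : ℤ, ∀ x ∈ L i, T x ∈ M i) :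
    ∃ t : ℤ →₀ (V →ₗ[k] W), (∀ j, 0 < j → t j = 0) ∧
      (∀ j, homAction B A (t j) = (j : k) • t j) ∧ ∑ j ∈ t.support, t j = T := by
  let p (j : ℤ) : Submodule k (V →ₗ[k] W) :=
    ⨆ _ : j ≤ 0, (homAction B A).eigenspace (j : k)
  have hmem : T ∈ ⨆ j, p j := by
    obtain ⟨ι, _, b, μ, hb⟩ := exists_basis_intEigen A hA.1
    have hcoord (i : ι) (x : V) : b.coord i (A x) = (μ i : k) * b.coord i x := by
      have : b.coord i ∘ₗ A = (μ i : k) • b.coord i := b.ext fun j ↦ by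
        classical
        by_cases hij : j = i
        · subst hij; simp [hb]
        · simp [hb, Finsupp.single_eq_of_ne (Ne.symm hij)]
      exact LinearMap.congr_fun this x
    have hsum : T = ∑ i, (b.coord i).smulRight (T (b i)) := by
      classical
      refine b.ext fun j ↦ ?_
      simp [LinearMap.sum_apply, Finsupp.single_apply]
    rw [hsum]
    refine Submodule.sum_mem _ fun i _ ↦ ?_
    have hbi : b i ∈ L (μ i) := by
      rw [hA.2]
      refine Submodule.mem_iSup_of_mem (μ i) (Submodule.mem_iSup_of_mem le_rfl ?_)
      simp [hb]
    have hTb := hT _ _ hbi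
    rw [hB.2] at hTb
    let φ : W →ₗ[k] V →ₗ[k] W := LinearMap.smulRightₗ (b.coord i)
    suffices h : (⨆ j : ℤ, ⨆ _ : j ≤ μ i, LinearMap.ker (B - (j : k) • 1)) ≤
        (⨆ j, p j).comap φ from h hTb
    refine iSup₂_le fun j hj y hy ↦ ?_
    have hy' : B y = (j : k) • y := by simpa [sub_eq_zero] using hy
    refine Submodule.mem_iSup_of_mem (j - μ i) (Submodule.mem_iSup_of_mem (by omega) ?_)
    rw [Module.End.mem_eigenspace_iff]
    ext x
    have := hcoord i x
    simp only [Module.Basis.coord_apply] at this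
    simp [φ, homAction_apply, hy', this, sub_smul, smul_smul, mul_comm]
  obtain ⟨t, ht, hsum⟩ := (Submodule.mem_iSup_iff_exists_finsupp _ _).1 hmem
  refine ⟨t, fun j hj ↦ ?_, fun j ↦ ?_, hsum⟩
  · simpa [p, hj.not_ge] using ht j
  · rw [← Module.End.mem_eigenspace_iff]
    exact (iSup_const_le : p j ≤ _) (ht j)

/-- Let `(V, L, N, Y, Y')` and `(V̂, L̂, N̂, Ŷ, Ŷ')` be Deligne systems
over a field `k` of characteristic zero, on finite-dimensional spaces, and let
`T : V → V̂` be linear with `Ŷ∘T = T∘Y`, `N̂∘T = T∘N` and `T(L_i) ⊆ L̂_i` for all `i`.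
Then `Ŷ'∘T = T∘Y'`. -/
theorem statement8 [CharZero k] [FiniteDimensional k V]
    {Vh : Type*} [AddCommGroup Vh] [Module k Vh] [FiniteDimensional k Vh]
    (L : ℤ → Submodule k V) (N Y Y' : Module.End k V)
    (hsys : IsDeligneSystem L N Y Y')
    (Lh : ℤ → Submodule k Vh) (Nh Yh Yh' : Module.End k Vh)
    (hsysh : IsDeligneSystem Lh Nh Yh Yh')
    (T : V →ₗ[k] Vh)
    (hTY : Yh ∘ₗ T = T ∘ₗ Y)
    (hTN : Nh ∘ₗ T = T ∘ₗ N)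
    (hTL : ∀ i : ℤ, ∀ x ∈ L i, T x ∈ Lh i) :
    Yh' ∘ₗ T = T ∘ₗ Y' := by
  obtain ⟨-, -, -, -, -, -, -, -, hS, hYY, Nc, hNfin, hNpos, hNsum, hNdeg, e, he0, heH, hen⟩ := hsys
  obtain ⟨-, -, -, -, -, -, -, -, hSh, hYYh, Nch, hNfinh, hNposh, hNsumh, hNdegh, eh, he0h, heHh,
    henh⟩ := hsysh
  obtain ⟨t, ht0, ht, rfl⟩ := exists_homogeneous_decomposition hS hSh T hTL
  classical
  let I : Finset ℤ := hNfin.toFinset ∪ hNfinh.toFinset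
  have hI : ∑ i ∈ I, Nc i = N := by
    rw [← hNsum, finsum_eq_sum_of_support_subset]
    simp [I]
  have hIh : ∑ i ∈ I, Nch i = Nh := by
    rw [← hNsumh, finsum_eq_sum_of_support_subset]
    simp [I]
  have key : homAction Yh' Y' (∑ j ∈ t.support, t j) = 0 := by
    refine apply_eq_zero_of_deligne_triple (homAction Yh' Y') (homAction Yh Y) (homAction eh e)
      (fun i ↦ homAction (Nch i) (Nc i)) I t.support (fun i hi ↦ ?_) (fun i hi ↦ ?_) (fun i ↦ ?_)
      ?_ ?_ (fun i hi ↦ ?_) ?_ t (fun j hj ↦ by simpa using hj) ht0 ht ?_ ?_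
    · simp only [I, Finset.mem_union, Set.Finite.mem_toFinset, Function.mem_support, not_or,
        not_not] at hi
      ext; simp [homAction_apply, hi]
    · ext; simp [homAction_apply, hNpos i hi, hNposh i hi]
    · rw [homAction_commutator, hNdeg, hNdegh, homAction_smul]
    · rw [homAction_commutator, he0, he0h, homAction_sub]
    · rw [← homAction_sub, homAction_commutator, heH, heHh, homAction_smul]
    · rw [← sub_eq_zero, homAction_commutator, hen i hi, henh i hi]
      ext; simp [homAction_apply]
    · rw [commute_iff_eq, ← sub_eq_zero, homAction_commutator, hYY.eq, hYYh.eq]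
      ext; simp [homAction_apply]
    · rw [homAction_apply, hTY, sub_self]
    · rw [sum_homAction, hI, hIh, homAction_apply, hTN, sub_self]
  rwa [homAction_apply, sub_eq_zero] at key
end
end

section
/- Let M be a complex vector space equipped with a rank-r Weyl system t_1,…,t_r, ∂_1,…,∂_r and an abstract V-filtration (V^χ)_{χ∈ℚ}. Let (F_p)_{p∈ℤ} be an increasing exhaustive family of subspaces of M (F_p ⊆ F_{p+1}, ⋃_p F_p = M) with t_i(F_p) ⊆ F_p for all i, p. Assume that for every rational χ > 0 and every p ∈ ℤ the complex whose ℓ-th term (ℓ = 0,…,r) is (F_p ∩ V^{χ+ℓ}) ⊗ Λ^ℓ(ℂ^r) and whose differential is m⊗ω ↦ Σ_{i=1}^r t_i(m)⊗(e_i∧ω) is exact. Then for every m ∈ V^{>0} := ⋃_{χ>0} V^χ and every p ∈ ℤ: m ∈ F_p if and only if there exists ℓ ≥ 0 such that t^α(m) ∈ F_p for every α ∈ ℕ^r with |α| = ℓ, where t^α := t_1^{α_1}∘…∘t_r^{α_r}. -/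
open TensorProduct

noncomputable section

/-- Wedging on the left with a fixed vector `v`, as a linear map `⋀^ℓ M → ⋀^(ℓ+1) M`,
`ω ↦ v ∧ ω`. -/
def wedgeMap (R : Type*) [CommRing R] {M : Type*} [AddCommGroup M] [Module R M]
    (v : M) (ℓ : ℕ) : ⋀[R]^ℓ M →ₗ[R] ⋀[R]^(ℓ+1) M :=
  LinearMap.codRestrict _
    ((LinearMap.mulLeft R (ExteriorAlgebra.ι R v)).comp (Submodule.subtype _))
    (fun ω => by
      have h : ExteriorAlgebra.ι R v * (ω : ExteriorAlgebra R M) ∈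
          (LinearMap.range (ExteriorAlgebra.ι R : M →ₗ[R] ExteriorAlgebra R M)) ^ (ℓ + 1) := by
        rw [pow_succ']
        exact Submodule.mul_mem_mul (LinearMap.mem_range_self _ v) ω.2
      simpa using h)

/-- `V^{>χ} := ⋃_{β > χ} V^β` (a union of a directed family of subspaces, hence the sup). -/
def Vgt {M : Type*} [AddCommGroup M] [Module ℂ M] (V : ℚ → Submodule ℂ M) (χ : ℚ) :
    Submodule ℂ M :=
  ⨆ β > χ, V β

theorem wedgeMap_wedgeMap_swap {R : Type*} [CommRing R] {M : Type*} [AddCommGroup M] [Module R M]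
    (v w : M) (n : ℕ) (ω : ⋀[R]^n M) :
    wedgeMap R v (n + 1) (wedgeMap R w n ω) = -wedgeMap R w (n + 1) (wedgeMap R v n ω) := by
  apply Subtype.ext
  change ExteriorAlgebra.ι R v * (ExteriorAlgebra.ι R w * (ω : ExteriorAlgebra R M)) =
    -(ExteriorAlgebra.ι R w * (ExteriorAlgebra.ι R v * (ω : ExteriorAlgebra R M)))
  rw [← mul_assoc, ← mul_assoc, ← neg_mul,
    eq_neg_of_add_eq_zero_left (ExteriorAlgebra.ι_add_mul_swap v w)]

section Koszul

variable {r : ℕ} {M : Type*} [AddCommGroup M] [Module ℂ M]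

/-- The restrictions of the `t i` to a family of subspaces `N n` with `t i (N n) ⊆ N (n + 1)`. -/
def koszulShift (t : Fin r → Module.End ℂ M) (N : ℕ → Submodule ℂ M)
    (hN : ∀ n i, ∀ m ∈ N n, t i m ∈ N (n + 1)) (n : ℕ) (i : Fin r) : N n →ₗ[ℂ] N (n + 1) :=
  (t i).restrict (hN n i)

/-- The Koszul differential `m ⊗ ω ↦ ∑ i, t i m ⊗ (e i ∧ ω)`. -/
def koszulDiff (t : Fin r → Module.End ℂ M) (N : ℕ → Submodule ℂ M)
    (hN : ∀ n i, ∀ m ∈ N n, t i m ∈ N (n + 1)) (n : ℕ) :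
    (N n ⊗[ℂ] ⋀[ℂ]^n (Fin r → ℂ)) →ₗ[ℂ] (N (n + 1) ⊗[ℂ] ⋀[ℂ]^(n + 1) (Fin r → ℂ)) :=
  ∑ i, TensorProduct.map (koszulShift t N hN n i) (wedgeMap ℂ (Pi.single i 1) n)

theorem koszulDiff_tmul (t : Fin r → Module.End ℂ M) (N : ℕ → Submodule ℂ M)
    (hN : ∀ n i, ∀ m ∈ N n, t i m ∈ N (n + 1)) (n : ℕ) (x : N n) (ω : ⋀[ℂ]^n (Fin r → ℂ)) :
    koszulDiff t N hN n (x ⊗ₜ[ℂ] ω) =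
      ∑ i, koszulShift t N hN n i x ⊗ₜ[ℂ] wedgeMap ℂ (Pi.single i 1) n ω := by
  simp [koszulDiff, LinearMap.sum_apply]

theorem exteriorPower_zero_tmul_surjective (N : Type*) [AddCommGroup N] [Module ℂ N]
    (E : Type*) [AddCommGroup E] [Module ℂ E] (y : N ⊗[ℂ] ⋀[ℂ]^0 E) :
    ∃ x : N, y = x ⊗ₜ[ℂ] (exteriorPower.zeroEquiv ℂ E).symm 1 := by
  induction y with
  | zero => exact ⟨0, by simp⟩
  | tmul x ω =>
    refine ⟨exteriorPower.zeroEquiv ℂ E ω • x, ?_⟩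
    rw [TensorProduct.smul_tmul, ← map_smul, smul_eq_mul, mul_one, LinearEquiv.symm_apply_apply]
  | add a b ha hb =>
    obtain ⟨x, rfl⟩ := ha
    obtain ⟨y, rfl⟩ := hb
    exact ⟨x + y, (TensorProduct.add_tmul _ _ _).symm⟩

theorem exteriorPower_zero_tmul_injective (N : Type*) [AddCommGroup N] [Module ℂ N]
    (E : Type*) [AddCommGroup E] [Module ℂ E] (x : N)
    (hx : x ⊗ₜ[ℂ] (exteriorPower.zeroEquiv ℂ E).symm 1 = 0) : x = 0 := by
  have h := congrArg (fun y => TensorProduct.rid ℂ N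
    (TensorProduct.map LinearMap.id (exteriorPower.zeroEquiv ℂ E).toLinearMap y)) hx
  simpa using h

/-- If the Koszul complex of `N` is exact in degree one and that of a larger family `N'` is exact
in degree zero, then any element of `N' 0` that all `t i` send to `N 1` lies in `N 0`. -/
theorem mem_of_koszul_exact (t : Fin r → Module.End ℂ M) (htt : ∀ i j, t i * t j = t j * t i)
    (N N' : ℕ → Submodule ℂ M)
    (hN : ∀ n i, ∀ m ∈ N n, t i m ∈ N (n + 1)) (hN' : ∀ n i, ∀ m ∈ N' n, t i m ∈ N' (n + 1))
    (hle : ∀ n, N n ≤ N' n)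
    (hex : LinearMap.ker (koszulDiff t N hN 1) = LinearMap.range (koszulDiff t N hN 0))
    (hinj : LinearMap.ker (koszulDiff t N' hN' 0) = ⊥)
    (m : M) (hm : m ∈ N' 0) (htm : ∀ i, t i m ∈ N 1) : m ∈ N 0 := by
  set e := (exteriorPower.zeroEquiv ℂ (Fin r → ℂ)).symm 1
  set z : N 1 ⊗[ℂ] ⋀[ℂ]^1 (Fin r → ℂ) :=
    ∑ i, (⟨t i m, htm i⟩ : N 1) ⊗ₜ[ℂ] wedgeMap ℂ (Pi.single i 1) 0 e with hz
  have hcycle : z ∈ LinearMap.ker (koszulDiff t N hN 1) := by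
    rw [LinearMap.mem_ker, hz, map_sum]
    simp only [koszulDiff_tmul]
    have : IsAddTorsionFree (N (1 + 1) ⊗[ℂ] ⋀[ℂ]^(1 + 1) (Fin r → ℂ)) :=
      letI := Module.compHom (N (1 + 1) ⊗[ℂ] ⋀[ℂ]^(1 + 1) (Fin r → ℂ)) (algebraMap ℚ ℂ)
      .of_module_rat _
    rw [← self_eq_neg]
    conv_lhs => rw [Finset.sum_comm]
    simp only [← Finset.sum_neg_distrib]
    refine Finset.sum_congr rfl fun i _ => Finset.sum_congr rfl fun j _ => ?_
    rw [wedgeMap_wedgeMap_swap, TensorProduct.tmul_neg]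
    congr 2
    exact Subtype.ext (DFunLike.congr_fun (htt i j) m)
  rw [hex] at hcycle
  obtain ⟨y, hy⟩ := hcycle
  obtain ⟨x, rfl⟩ := exteriorPower_zero_tmul_surjective _ _ y
  have hdiff : (⟨m, hm⟩ : N' 0) - Submodule.inclusion (hle 0) x = 0 := by
    apply exteriorPower_zero_tmul_injective _ (Fin r → ℂ)
    rw [← Submodule.mem_bot ℂ, ← hinj, LinearMap.mem_ker, TensorProduct.sub_tmul, map_sub,
      sub_eq_zero]
    have h := congrArg (TensorProduct.map (Submodule.inclusion (hle 1)) LinearMap.id) hy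
    rw [koszulDiff_tmul, hz, map_sum, map_sum] at h
    rw [koszulDiff_tmul, koszulDiff_tmul]
    exact h.symm
  have hmx : m = x := congrArg Subtype.val (sub_eq_zero.mp hdiff)
  exact hmx ▸ x.2

end Koszul

theorem prod_ofFn_pow_add_single {A : Type*} [Monoid A] {r : ℕ} (t : Fin r → A)
    (htt : ∀ i j, t i * t j = t j * t i) (i : Fin r) (α : Fin r → ℕ) :
    (List.ofFn fun j => t j ^ (α + Pi.single i 1 : Fin r → ℕ) j).prod =
      (List.ofFn fun j => t j ^ α j).prod * t i := by
  induction r with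
  | zero => exact i.elim0
  | succ r ih =>
    simp only [List.ofFn_succ, List.prod_cons]
    refine Fin.cases ?_ (fun k => ?_) i
    · have hc : Commute (t 0) (List.ofFn fun j : Fin r => t j.succ ^ α j.succ).prod :=
        Commute.list_prod_right _ _ fun x hx => by
          obtain ⟨j, rfl⟩ := (List.mem_ofFn' _ _).mp hx
          exact Commute.pow_right (htt _ _) _
      simp [pow_succ, mul_assoc, hc.eq]
    · have h := ih (fun j => t j.succ) (fun _ _ => htt _ _) k (fun j => α j.succ)
      have hs : ∀ j : Fin r, (Pi.single k.succ 1 : Fin (r + 1) → ℕ) j.succ =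
          (Pi.single k 1 : Fin r → ℕ) j := fun j => by
        simp [Pi.single_apply]
      simp only [Pi.add_apply] at h ⊢
      simp only [hs, h, mul_assoc]
      simp

/-- Let `M` be a complex vector space with a rank-`r` Weyl system
`t_1, …, t_r, ∂_1, …, ∂_r` and an abstract V-filtration `(V^χ)_χ`.  Let `(F_p)_{p ∈ ℤ}`
be an increasing exhaustive family of subspaces with `tᵢ(F_p) ⊆ F_p`.  Assume that for
every rational `χ > 0` and every `p` the Koszul-type complex with `ℓ`-th term
`(F_p ∩ V^{χ+ℓ}) ⊗ Λ^ℓ(ℂ^r)` and differential `m ⊗ ω ↦ Σᵢ tᵢ(m) ⊗ (eᵢ ∧ ω)` is exact.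
Then for every `m ∈ V^{>0}` and every `p`:  `m ∈ F_p` iff there exists `ℓ ≥ 0` such that
`t^α(m) ∈ F_p` for every `α ∈ ℕ^r` with `|α| = ℓ`. -/
theorem statement10 (r : ℕ) (hr : 1 ≤ r)
    (M : Type*) [AddCommGroup M] [Module ℂ M]
    (t d : Fin r → Module.End ℂ M)
    (htt : ∀ i j, t i * t j = t j * t i)
    (hdd : ∀ i j, d i * d j = d j * d i)
    (hdt : ∀ i j, d i * t j - t j * d i = if i = j then 1 else 0)
    (θ : Module.End ℂ M) (hθ : θ = ∑ i, t i * d i)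
    (V : ℚ → Submodule ℂ M)
    (hmono : ∀ ⦃χ χ' : ℚ⦄, χ ≤ χ' → V χ' ≤ V χ)
    (hVt : ∀ (i : Fin r) (χ : ℚ), ∀ m ∈ V χ, t i m ∈ V (χ + 1))
    (hVd : ∀ (i : Fin r) (χ : ℚ), ∀ m ∈ V χ, d i m ∈ V (χ - 1))
    (hVnil : ∀ (χ : ℚ), ∀ m ∈ V χ, ∃ k : ℕ, 1 ≤ k ∧
      (((θ - ((χ : ℂ) - (r : ℂ)) • 1) ^ k) m ∈ Vgt V χ))
    (F : ℤ → Submodule ℂ M)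
    (hFmono : Monotone F)
    (hFexh : (⨆ p : ℤ, F p) = ⊤)
    (hFt : ∀ (i : Fin r) (p : ℤ), ∀ m ∈ F p, t i m ∈ F p)
    -- filtered acyclicity of the complexes `A^χ` for `χ > 0`
    (hexact : ∀ (χ : ℚ), 0 < χ → ∀ (p : ℤ)
      (T : ∀ (n : ℕ), Fin r → ((F p ⊓ V (χ + n) : Submodule ℂ M) →ₗ[ℂ]
        (F p ⊓ V (χ + (n + 1 : ℕ)) : Submodule ℂ M))),
      (∀ (n : ℕ) (i : Fin r) (m : M) (hm : m ∈ F p ⊓ V (χ + n))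
          (hm' : t i m ∈ F p ⊓ V (χ + (n + 1 : ℕ))), T n i ⟨m, hm⟩ = ⟨t i m, hm'⟩) →
      ∀ (δ : ∀ n : ℕ, ((F p ⊓ V (χ + n) : Submodule ℂ M) ⊗[ℂ] ⋀[ℂ]^n (Fin r → ℂ)) →ₗ[ℂ]
          ((F p ⊓ V (χ + (n + 1 : ℕ)) : Submodule ℂ M) ⊗[ℂ] ⋀[ℂ]^(n+1) (Fin r → ℂ))),
        (∀ (n : ℕ) (x : (F p ⊓ V (χ + n) : Submodule ℂ M)) (ω : ⋀[ℂ]^n (Fin r → ℂ)),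
          δ n (x ⊗ₜ[ℂ] ω) = ∑ i, (T n i x) ⊗ₜ[ℂ] (wedgeMap ℂ (Pi.single i 1) n ω)) →
        (LinearMap.ker (δ 0) = ⊥ ∧
          ∀ n : ℕ, LinearMap.ker (δ (n+1)) = LinearMap.range (δ n))) :
    ∀ (p : ℤ) (m : M), m ∈ Vgt V 0 →
      (m ∈ F p ↔ ∃ ℓ : ℕ, ∀ α : Fin r → ℕ, (∑ i, α i) = ℓ →
        ((List.ofFn fun i => (t i) ^ (α i)).prod) m ∈ F p) := by
  have hstep : ∀ (p : ℤ) (χ : ℚ), 0 < χ → ∀ m ∈ V χ, (∀ i, t i m ∈ F p) → m ∈ F p := by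
    intro p χ hχ m hm htm
    have hN : ∀ (q : ℤ) (n : ℕ) (i : Fin r), ∀ x ∈ F q ⊓ V (χ + n),
        t i x ∈ F q ⊓ V (χ + (n + 1 : ℕ)) := fun q n i x hx =>
      ⟨hFt i q x hx.1, by simpa [add_assoc] using hVt i _ x hx.2⟩
    have hex : ∀ q : ℤ, _ := fun q =>
      hexact χ hχ q (koszulShift t (fun n => F q ⊓ V (χ + n)) (hN q)) (fun _ _ _ _ _ => rfl)
        (koszulDiff t _ (hN q)) (koszulDiff_tmul t _ (hN q))
    obtain ⟨q, hq⟩ := (Submodule.mem_iSup_of_directed F hFmono.directed_le).mp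
      (hFexh ▸ Submodule.mem_top : m ∈ ⨆ p, F p)
    refine (mem_of_koszul_exact t htt (fun n => F p ⊓ V (χ + n))
      (fun n => F (max p q) ⊓ V (χ + n)) (hN p) (hN _)
      (fun n => inf_le_inf_right _ (hFmono (le_max_left p q))) ((hex p).2 0) (hex _).1 m
      ⟨hFmono (le_max_right p q) hq, by simpa using hm⟩
      fun i => ⟨htm i, by simpa using hVt i χ m hm⟩).1
  have hdescend : ∀ (p : ℤ) (ℓ : ℕ) (χ : ℚ), 0 < χ → ∀ m ∈ V χ,
      (∀ α : Fin r → ℕ, (∑ i, α i) = ℓ →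
        ((List.ofFn fun i => (t i) ^ (α i)).prod) m ∈ F p) → m ∈ F p := by
    intro p ℓ
    induction ℓ with
    | zero =>
      intro χ _ m _ h
      simpa using h 0 (by simp)
    | succ ℓ ih =>
      intro χ hχ m hm h
      refine hstep p χ hχ m hm fun i =>
        ih (χ + 1) (by positivity) _ (hVt i χ m hm) fun α hα => ?_
      have := h (α + Pi.single i 1) (by simp [Finset.sum_add_distrib, hα])
      rwa [prod_ofFn_pow_add_single t htt] at this
  intro p m hm
  constructor
  · intro hmF
    refine ⟨0, fun α hα => ?_⟩
    obtain rfl : α = 0 := funext fun i => Finset.sum_eq_zero_iff.mp hα i (Finset.mem_univ i)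
    simpa using hmF
  · rintro ⟨ℓ, hℓ⟩
    have hle : Vgt V 0 = ⨆ β : {β : ℚ // 0 < β}, V β := iSup_subtype'
    have : Nonempty {β : ℚ // 0 < β} := ⟨⟨1, one_pos⟩⟩
    have hanti : Antitone fun β : {β : ℚ // 0 < β} => V β := fun a b hab => hmono hab
    rw [hle, Submodule.mem_iSup_of_directed _ hanti.directed_le] at hm
    obtain ⟨χ, hχ⟩ := hm
    exact hdescend p ℓ χ χ.2 m hχ hℓ
end
end
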